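/- Central limit theorem for the total initial and target states: let p, q be probability vectors of dimension d with D(p) > 0, D(q) > 0, V(p) > 0, V(q) > 0, let η be the uniform vector of dimension d, and let μ ∈ ℝ. Define R_μ(n) := (1/D(q))·[D(p) + μ·√(D(p)·V(q)/(D(q)·n))], let (m_n) be any sequence of positive integers with m_n − n·R_μ(n) bounded, and set Pⁿ := p^{⊗n} ⊗ η^{⊗m_n}, Qⁿ := q^{⊗m_n} ⊗ η^{⊗n}, and K_n(x) := ⌊exp(m_n·H(q) + n·log d + x·√(m_n·V(q)))⌋. Then for every x ∈ ℝ: (i) lim_{n→∞} Σ_{i=1}^{K_n(x)} (Qⁿ)↓_i = Φ(x); and (ii) lim_{n→∞} Σ_{i=1}^{K_n(x)} (Pⁿ)↓_i = Φ_{μ,ν}(x), where ν := (V(p)/D(p))/(V(q)/D(q)). -/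

import Mathlib

open Finset Filter

noncomputable section

/-- A probability vector: nonnegative entries summing to 1. -/
def IsProbVec {ι : Type*} [Fintype ι] (p : ι → ℝ) : Prop :=
  (∀ i, 0 ≤ p i) ∧ ∑ i, p i = 1

/-- The sum of the `k` largest entries of `p`: the largest sum over subsets of at
most `k` indices (for nonnegative vectors this equals the sorted partial sum,
with zero padding beyond the dimension). -/
def kMaxSum {ι : Type*} [Fintype ι] (p : ι → ℝ) (k : ℕ) : ℝ :=
  (Finset.univ.powerset.filter (fun s : Finset ι => s.card ≤ k)).sup'
    ⟨∅, by simp⟩ (fun s => ∑ i ∈ s, p i)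

/-- `p ≻ q`: for every `k`, the sum of the `k` largest entries of `p` is at least
that of `q` (dimensions may differ, the shorter padded with zeros). -/
def Majorises {ι κ : Type*} [Fintype ι] [Fintype κ] (p : ι → ℝ) (q : κ → ℝ) : Prop :=
  ∀ k : ℕ, kMaxSum q k ≤ kMaxSum p k

/-- Fidelity `F(p,q) = (Σ_i √(p_i q_i))²`. -/
def fidelity {ι : Type*} [Fintype ι] (p q : ι → ℝ) : ℝ :=
  (∑ i, Real.sqrt (p i * q i)) ^ 2

/-- Infidelity `δ(p,q) = 1 - F(p,q)`. -/
def infid {ι : Type*} [Fintype ι] (p q : ι → ℝ) : ℝ := 1 - fidelity p q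

/-- The `n`-fold tensor (Kronecker) power of `a`, as a vector indexed by
`Fin n → Fin d` (a probability vector of dimension `d^n`). -/
def tensorPow {d : ℕ} (a : Fin d → ℝ) (n : ℕ) : (Fin n → Fin d) → ℝ :=
  fun f => ∏ j, a (f j)

/-- Shannon entropy `H(p) = -Σ_i p_i log p_i`. -/
def shannonH {ι : Type*} [Fintype ι] (p : ι → ℝ) : ℝ := -∑ i, p i * Real.log (p i)

/-- Entropy variance `V(p) = Σ_i p_i (-log p_i - H(p))²`. -/
def entVar {ι : Type*} [Fintype ι] (p : ι → ℝ) : ℝ :=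
  ∑ i, p i * (-Real.log (p i) - shannonH p) ^ 2

/-- Relative entropy to the uniform distribution: `D(p) = log d - H(p)`. -/
def relD {d : ℕ} (p : Fin d → ℝ) : ℝ := Real.log d - shannonH p

/-- Density of the normal distribution with mean `μ` and variance `v`. -/
def normPDF (μ v x : ℝ) : ℝ :=
  Real.exp (-((x - μ) ^ 2) / (2 * v)) / Real.sqrt (2 * Real.pi * v)

/-- Cumulative distribution function `Φ_{μ,v}` of the normal distribution. -/
def normCDF (μ v x : ℝ) : ℝ := ∫ t in Set.Iic x, normPDF μ v t

/-- The standard normal cumulative distribution function `Φ`. -/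
def Phi (x : ℝ) : ℝ := normCDF 0 1 x

section NormalApproximation

open MeasureTheory ProbabilityTheory

/-- The central limit theorem for i.i.d. sums on finite product spaces, along a sequence of sample
sizes tending to infinity and with convergent thresholds. -/
lemma tendsto_pi_real_inv_sqrt_mul_sum_le {Ω : Type*} [MeasurableSpace Ω] (P : Measure Ω)
    [IsProbabilityMeasure P] {X : Ω → ℝ} (hX : Measurable X) (h0 : P[X] = 0) (h1 : P[X ^ 2] = 1)
    {N : ℕ → ℕ} (hN : Tendsto N atTop atTop) {y : ℕ → ℝ} {y₀ : ℝ}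
    (hy : Tendsto y atTop (nhds y₀)) :
    Tendsto (fun n => (Measure.pi (fun _ : Fin (N n) => P)).real
      {f | (√(N n))⁻¹ * ∑ j, X (f j) ≤ y n}) atTop
      (nhds ((gaussianReal (-y₀) 1).real (Set.Iic 0))) := by
  have hmeas (n : ℕ) : Measurable
      (fun f : Fin (N n) → Ω => -y n + (√(N n))⁻¹ * ∑ j, X (f j)) := by fun_prop
  let L (n : ℕ) : ProbabilityMeasure ℝ :=
    ⟨(Measure.pi (fun _ : Fin (N n) => P)).map
      (fun f => -y n + (√(N n))⁻¹ * ∑ j, X (f j)),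
      Measure.isProbabilityMeasure_map (hmeas n).aemeasurable⟩
  let G : ProbabilityMeasure ℝ := ⟨gaussianReal (-y₀) 1, inferInstance⟩
  have hchar (n : ℕ) (t : ℝ) : charFun (L n : Measure ℝ) t =
      (charFun (P.map X) ((√(N n))⁻¹ * t)) ^ (N n) * Complex.exp (-(t * y n) * Complex.I) := by
    have hL : (L n : Measure ℝ) = (((Measure.pi (fun _ : Fin (N n) => P)).map
        (fun f => (√(N n))⁻¹ * ∑ j, X (f j))).map (fun z => z + (-y n))) := by
      rw [Measure.map_map (by fun_prop) (by fun_prop)]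
      simp only [L, ProbabilityMeasure.coe_mk]
      congr 1
      ext f
      simp [add_comm]
    have hindep : iIndepFun (fun (j : Fin (N n)) (f : Fin (N n) → Ω) => X (f j))
        (Measure.pi (fun _ : Fin (N n) => P)) :=
      iIndepFun_pi (fun _ => hX.aemeasurable)
    have hmap (j : Fin (N n)) :
        (Measure.pi (fun _ : Fin (N n) => P)).map (fun f => X (f j)) = P.map X := by
      conv_rhs => rw [← (measurePreserving_eval (fun _ : Fin (N n) => P) j).map_eq,
        Measure.map_map hX (measurable_pi_apply j)]
      rfl
    rw [hL, charFun_map_add_const, 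
      charFun_map_mul_comp (Measurable.aemeasurable (by fun_prop)),
      hindep.charFun_map_fun_sum_eq_prod (fun j => Measurable.aemeasurable (by fun_prop))]
    simp [hmap, mul_comm]
  have hlim : Tendsto L atTop (nhds G) := by
    refine ProbabilityMeasure.tendsto_iff_tendsto_charFun.2 fun t => ?_
    simp_rw [hchar]
    have hφ := (tendsto_charFun_inv_sqrt_mul_pow hX.aemeasurable h0 h1 t).comp hN
    have hexp : Tendsto (fun n => Complex.exp (-(t * y n) * Complex.I)) atTop
        (nhds (Complex.exp (-(t * y₀) * Complex.I))) := by
      have : Continuous (fun z : ℝ => Complex.exp (-(t * z) * Complex.I)) := by fun_prop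
      exact (this.tendsto y₀).comp hy
    have hG : charFun (G : Measure ℝ) t =
        Complex.exp (-t ^ 2 / 2) * Complex.exp (-(t * y₀) * Complex.I) := by
      simp only [G, ProbabilityMeasure.coe_mk, charFun_gaussianReal, ← Complex.exp_add]
      congr 1
      push_cast
      ring
    rw [hG]
    exact hφ.mul hexp
  have hIic := ProbabilityMeasure.tendsto_measure_of_null_frontier_of_tendsto' hlim
    (E := Set.Iic 0) (by
      have := nullSingletonClass_gaussianReal (μ := -y₀) (v := 1) one_ne_zero
      simp [G])
  refine ((ENNReal.tendsto_toReal (measure_ne_top _ _)).comp hIic).congr fun n => ?_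
  simp only [Function.comp_apply, L, ProbabilityMeasure.coe_mk, Measure.real,
    Measure.map_apply (hmeas n) measurableSet_Iic]
  congr 2
  ext f
  simp

lemma normCDF_eq_gaussianReal (μ : ℝ) {v : ℝ} (hv : 0 < v) (x : ℝ) :
    normCDF μ v x = (gaussianReal (-((x - μ) / √v)) 1).real (Set.Iic 0) := by
  have hmap : (gaussianReal μ v.toNNReal).map (fun z => (z - x) / √v) =
      gaussianReal (-((x - μ) / √v)) 1 := by
    have := Measure.map_map (μ := gaussianReal μ v.toNNReal) (g := fun z : ℝ => z / √v)
      (f := fun z : ℝ => z - x) (by fun_prop) (by fun_prop)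
    rw [gaussianReal_map_sub_const, gaussianReal_map_div_const] at this
    rw [show (fun z => (z - x) / √v) = (fun z : ℝ => z / √v) ∘ (fun z : ℝ => z - x) from rfl,
      ← this]
    congr 1
    · ring
    · ext
      simp [Real.sq_sqrt hv.le, hv.le, hv.ne']
  have hpre : (fun z => (z - x) / √v) ⁻¹' Set.Iic 0 = Set.Iic x := by
    ext z
    simp [div_nonpos_iff, Real.sqrt_nonneg, not_le.2 (Real.sqrt_pos.2 hv)]
  rw [← hmap, Measure.real, Measure.map_apply (by fun_prop) measurableSet_Iic, hpre,
    gaussianReal_apply_eq_integral _ (by simpa using hv),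
    ENNReal.toReal_ofReal (integral_nonneg fun _ => gaussianPDFReal_nonneg _ _ _)]
  simp only [normCDF, normPDF, gaussianPDFReal, Real.coe_toNNReal v hv.le, div_eq_inv_mul,
    mul_comm]

end NormalApproximation

section LargestEntries

variable {ι : Type*} [Fintype ι]

lemma sum_le_kMaxSum (p : ι → ℝ) {k : ℕ} {s : Finset ι} (hs : s.card ≤ k) :
    ∑ i ∈ s, p i ≤ kMaxSum p k :=
  Finset.le_sup' (fun s : Finset ι => ∑ i ∈ s, p i) (by simpa using hs)

lemma kMaxSum_le {p : ι → ℝ} {k : ℕ} {b : ℝ}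
    (h : ∀ s : Finset ι, s.card ≤ k → ∑ i ∈ s, p i ≤ b) : kMaxSum p k ≤ b :=
  Finset.sup'_le _ _ fun s hs => h s (by simpa using hs)

end LargestEntries

section TensorPower

variable {d : ℕ} {a : Fin d → ℝ}

lemma IsProbVec.dim_pos (ha : IsProbVec a) : 0 < d := by
  rcases Nat.eq_zero_or_pos d with rfl | h
  · simpa using ha.2
  · exact h

lemma tensorPow_nonneg (ha : ∀ i, 0 ≤ a i) (N : ℕ) (f : Fin N → Fin d) : 0 ≤ tensorPow a N f :=
  Finset.prod_nonneg fun _ _ => ha _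

lemma sum_tensorPow (ha : ∑ i, a i = 1) (N : ℕ) : ∑ f, tensorPow a N f = 1 := by
  simp only [tensorPow, ← Fintype.sum_pow, ha, one_pow]

lemma isProbVec_uniform (hd : 0 < d) : IsProbVec (fun _ : Fin d => (d : ℝ)⁻¹) := by
  refine ⟨fun _ => by positivity, ?_⟩
  have : (d : ℝ) ≠ 0 := by positivity
  simp [this]

lemma tensorPow_eq_exp (ha : ∀ i, 0 ≤ a i) {N : ℕ} {f : Fin N → Fin d}
    (hf : tensorPow a N f ≠ 0) :
    tensorPow a N f = Real.exp (-∑ j, -Real.log (a (f j))) := by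
  have hpos (j : Fin N) : 0 < a (f j) :=
    (ha _).lt_of_ne' (Finset.prod_ne_zero_iff.1 hf j (Finset.mem_univ j))
  simp [tensorPow, Real.exp_sum, Real.exp_log (hpos _)]

lemma tensorPow_uniform (hd : 0 < d) (M : ℕ) (g : Fin M → Fin d) :
    tensorPow (fun _ : Fin d => (d : ℝ)⁻¹) M g = Real.exp (-(M * Real.log d)) := by
  have : (0 : ℝ) < d := by positivity
  rw [Real.exp_neg, mul_comm, Real.exp_mul, Real.exp_log this]
  simp [tensorPow]

/-- The probability, under the `N`-fold tensor power of `a`, that the surprisal is at most `t`. -/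
def surprisalCDF (a : Fin d → ℝ) (N : ℕ) (t : ℝ) : ℝ :=
  ∑ f : Fin N → Fin d, if ∑ j, -Real.log (a (f j)) ≤ t then tensorPow a N f else 0

lemma surprisalCDF_le_kMaxSum (ha : IsProbVec a) (N M : ℕ) (A : ℝ) :
    surprisalCDF a N (A - M * Real.log d) ≤
      kMaxSum (fun fg : (Fin N → Fin d) × (Fin M → Fin d) =>
        tensorPow a N fg.1 * tensorPow (fun _ : Fin d => (d : ℝ)⁻¹) M fg.2) ⌊Real.exp A⌋₊ := by
  classical
  have hd := ha.dim_pos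
  have hη := isProbVec_uniform hd
  let T : Finset (Fin N → Fin d) := Finset.univ.filter fun f =>
    ∑ j, -Real.log (a (f j)) ≤ A - M * Real.log d ∧ tensorPow a N f ≠ 0
  have hsum : ∑ fg ∈ T ×ˢ (Finset.univ : Finset (Fin M → Fin d)),
      tensorPow a N fg.1 * tensorPow (fun _ : Fin d => (d : ℝ)⁻¹) M fg.2 =
        surprisalCDF a N (A - M * Real.log d) := by
    simp only [Finset.sum_product, ← Finset.mul_sum, sum_tensorPow hη.2, mul_one, surprisalCDF, T,
      Finset.sum_filter]
    refine Finset.sum_congr rfl fun f _ => ?_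
    by_cases h : tensorPow a N f = 0 <;> simp [h]
  have hle_one : surprisalCDF a N (A - M * Real.log d) ≤ 1 := by
    rw [← sum_tensorPow ha.2 N]
    refine Finset.sum_le_sum fun f _ => ?_
    split_ifs
    exacts [le_rfl, tensorPow_nonneg ha.1 N f]
  rw [← hsum]
  refine sum_le_kMaxSum _ (Nat.le_floor ?_)
  have hcard : ((T ×ˢ (Finset.univ : Finset (Fin M → Fin d))).card : ℝ) * Real.exp (-A) ≤ 1 := by
    rw [← nsmul_eq_mul]
    refine (Finset.card_nsmul_le_sum _ _ _ fun fg hfg => ?_).trans (hsum.trans_le hle_one)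
    have hfg' := (Finset.mem_filter.1 (Finset.mem_product.1 hfg).1).2
    rw [tensorPow_eq_exp ha.1 hfg'.2, tensorPow_uniform hd, ← Real.exp_add]
    exact Real.exp_le_exp.2 (by linarith [hfg'.1])
  rwa [Real.exp_neg, ← div_eq_mul_inv, div_le_one (Real.exp_pos A)] at hcard

lemma kMaxSum_le_surprisalCDF_add (ha : IsProbVec a) (N M : ℕ) (A δ : ℝ) :
    kMaxSum (fun fg : (Fin N → Fin d) × (Fin M → Fin d) =>
        tensorPow a N fg.1 * tensorPow (fun _ : Fin d => (d : ℝ)⁻¹) M fg.2) ⌊Real.exp A⌋₊ ≤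
      surprisalCDF a N (A + δ - M * Real.log d) + Real.exp (-δ) := by
  have hd := ha.dim_pos
  have hη := isProbVec_uniform hd
  refine kMaxSum_le fun s hs => ?_
  let w (fg : (Fin N → Fin d) × (Fin M → Fin d)) : ℝ :=
    (if ∑ j, -Real.log (a (fg.1 j)) ≤ A + δ - M * Real.log d then tensorPow a N fg.1 else 0) *
      tensorPow (fun _ : Fin d => (d : ℝ)⁻¹) M fg.2
  have hw (fg) : 0 ≤ w fg := by
    refine mul_nonneg ?_ (tensorPow_nonneg hη.1 M fg.2)
    split_ifs
    exacts [tensorPow_nonneg ha.1 N fg.1, le_rfl]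
  have hwsum : ∑ fg, w fg = surprisalCDF a N (A + δ - M * Real.log d) := by
    simp only [w, Fintype.sum_prod_type, ← Finset.mul_sum, sum_tensorPow hη.2, mul_one,
      surprisalCDF]
  have hpt (fg : (Fin N → Fin d) × (Fin M → Fin d)) :
      tensorPow a N fg.1 * tensorPow (fun _ : Fin d => (d : ℝ)⁻¹) M fg.2 ≤
        w fg + Real.exp (-(A + δ)) := by
    simp only [w]
    split_ifs with h
    · linarith [Real.exp_pos (-(A + δ))]
    · by_cases h0 : tensorPow a N fg.1 = 0
      · simp [h0, Real.exp_nonneg]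
      · rw [tensorPow_eq_exp ha.1 h0, tensorPow_uniform hd, ← Real.exp_add, zero_mul, zero_add]
        exact Real.exp_le_exp.2 (by linarith)
  have hcard : (s.card : ℝ) ≤ Real.exp A :=
    (Nat.cast_le.2 hs).trans (Nat.floor_le (Real.exp_nonneg A))
  calc ∑ fg ∈ s, tensorPow a N fg.1 * tensorPow (fun _ : Fin d => (d : ℝ)⁻¹) M fg.2
      ≤ ∑ fg ∈ s, (w fg + Real.exp (-(A + δ))) := Finset.sum_le_sum fun fg _ => hpt fg
    _ = ∑ fg ∈ s, w fg + s.card * Real.exp (-(A + δ)) := by simp [Finset.sum_add_distrib]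
    _ ≤ ∑ fg, w fg + Real.exp A * Real.exp (-(A + δ)) := by
        gcongr
        · exact fun fg _ _ => hw fg
        · exact s.subset_univ
    _ = surprisalCDF a N (A + δ - M * Real.log d) + Real.exp (-δ) := by
        rw [hwsum, ← Real.exp_add]
        ring_nf

open MeasureTheory ProbabilityTheory

lemma IsProbVec.exists_measure (ha : IsProbVec a) :
    ∃ P : Measure (Fin d), IsProbabilityMeasure P ∧ ∀ i, P.real {i} = a i := by
  have h : ∑ i, ENNReal.ofReal (a i) = 1 := by
    rw [← ENNReal.ofReal_sum_of_nonneg fun i _ => ha.1 i, ha.2, ENNReal.ofReal_one]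
  refine ⟨(PMF.ofFintype _ h).toMeasure, inferInstance, fun i => ?_⟩
  rw [Measure.real, PMF.toMeasure_apply_singleton _ _ (measurableSet_singleton i)]
  simp [ha.1 i]

lemma surprisalCDF_eq_pi_real {P : Measure (Fin d)} [IsProbabilityMeasure P]
    (hP : ∀ i, P.real {i} = a i) (N : ℕ) (t : ℝ) :
    surprisalCDF a N t =
      (Measure.pi (fun _ : Fin N => P)).real {f | ∑ j, -Real.log (a (f j)) ≤ t} := by
  have hset : {f : Fin N → Fin d | ∑ j, -Real.log (a (f j)) ≤ t} =
      ((Finset.univ.filter fun f : Fin N → Fin d => ∑ j, -Real.log (a (f j)) ≤ t :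
        Finset (Fin N → Fin d)) : Set (Fin N → Fin d)) := by
    ext f
    simp
  rw [hset, ← sum_measureReal_singleton, Finset.sum_filter, surprisalCDF]
  refine Finset.sum_congr rfl fun f _ => ?_
  simp [Measure.real, Measure.pi_singleton, ENNReal.toReal_prod, tensorPow, ← hP]

/-- The surprisal of the tensor powers of a probability vector is asymptotically normal. -/
lemma tendsto_surprisalCDF (ha : IsProbVec a) (hV : 0 < entVar a)
    {N : ℕ → ℕ} (hN : Tendsto N atTop atTop) {y : ℕ → ℝ} {y₀ : ℝ}
    (hy : Tendsto y atTop (nhds y₀)) :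
    Tendsto (fun n => surprisalCDF a (N n) (N n * shannonH a + y n * √(N n * entVar a))) atTop
      (nhds ((gaussianReal (-y₀) 1).real (Set.Iic 0))) := by
  obtain ⟨P, _, hP⟩ := ha.exists_measure
  let X (i : Fin d) : ℝ := (-Real.log (a i) - shannonH a) / √(entVar a)
  have h0 : P[X] = 0 := by
    rw [integral_fintype Integrable.of_finite]
    simp only [hP, smul_eq_mul, X, mul_div_assoc', ← Finset.sum_div, mul_sub,
      Finset.sum_sub_distrib, ← Finset.sum_mul, ha.2]
    simp [shannonH]
  have h1 : P[X ^ 2] = 1 := by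
    rw [integral_fintype Integrable.of_finite]
    simp only [hP, smul_eq_mul, X, Pi.pow_apply, div_pow, mul_div_assoc', ← Finset.sum_div,
      Real.sq_sqrt hV.le]
    exact div_self hV.ne'
  refine (tendsto_pi_real_inv_sqrt_mul_sum_le P (measurable_of_finite X) h0 h1 hN hy).congr' ?_
  filter_upwards [hN.eventually_gt_atTop 0] with n hn
  rw [surprisalCDF_eq_pi_real hP]
  congr 1
  ext f
  have hN' : 0 < √(N n : ℝ) := Real.sqrt_pos.2 (Nat.cast_pos.2 hn)
  have hV' : 0 < √(entVar a) := Real.sqrt_pos.2 hV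
  have hX : ∑ j, X (f j) = (∑ j, -Real.log (a (f j)) - N n * shannonH a) / √(entVar a) := by
    simp [X, ← Finset.sum_div, Finset.sum_sub_distrib]
  rw [Set.mem_ofPred_eq, Set.mem_ofPred_eq, hX, Real.sqrt_mul (Nat.cast_nonneg _), inv_mul_eq_div,
    div_div, div_le_iff₀ (by positivity), sub_le_iff_le_add', mul_comm √(entVar a)]

/-- Central limit theorem for the sorted partial sums of `a^{⊗N} ⊗ η^{⊗M}`. -/
lemma tendsto_kMaxSum_tensorPow_uniform (ha : IsProbVec a) (hV : 0 < entVar a)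
    {N M : ℕ → ℕ} (hN : Tendsto N atTop atTop) {y : ℕ → ℝ} {y₀ : ℝ}
    (hy : Tendsto y atTop (nhds y₀)) {A : ℕ → ℝ}
    (hA : ∀ᶠ n in atTop,
      A n = N n * shannonH a + M n * Real.log d + y n * √(N n * entVar a)) :
    Tendsto (fun n => kMaxSum (fun fg : (Fin (N n) → Fin d) × (Fin (M n) → Fin d) =>
        tensorPow a (N n) fg.1 * tensorPow (fun _ : Fin d => (d : ℝ)⁻¹) (M n) fg.2)
        ⌊Real.exp (A n)⌋₊) atTop
      (nhds ((gaussianReal (-y₀) 1).real (Set.Iic 0))) := by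
  have hsqrt : Tendsto (fun n => √(√(N n : ℝ))) atTop atTop :=
    Real.tendsto_sqrt_atTop.comp
      (Real.tendsto_sqrt_atTop.comp (tendsto_natCast_atTop_atTop.comp hN))
  have hy' : Tendsto (fun n => y n + (√(√(N n : ℝ)))⁻¹ * (√(entVar a))⁻¹) atTop (nhds y₀) := by
    simpa using hy.add ((tendsto_inv_atTop_zero.comp hsqrt).mul_const (√(entVar a))⁻¹)
  have hexp : Tendsto (fun n => Real.exp (-√(√(N n : ℝ)))) atTop (nhds 0) :=
    Real.tendsto_exp_atBot.comp (tendsto_neg_atTop_atBot.comp hsqrt)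
  have hupper := (tendsto_surprisalCDF ha hV hN hy').add hexp
  rw [add_zero] at hupper
  refine tendsto_of_tendsto_of_tendsto_of_le_of_le' (tendsto_surprisalCDF ha hV hN hy)
    hupper ?_ ?_
  · filter_upwards [hA] with n hn
    convert! surprisalCDF_le_kMaxSum ha (N n) (M n) (A n) using 2
    rw [hn]
    ring
  · filter_upwards [hA, hN.eventually_gt_atTop 0] with n hn hpos
    have hN' : 0 < √(√(N n : ℝ)) := Real.sqrt_pos.2 (Real.sqrt_pos.2 (Nat.cast_pos.2 hpos))
    have hV' : 0 < √(entVar a) := Real.sqrt_pos.2 hV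
    have hsq : √(N n : ℝ) = √(√(N n : ℝ)) * √(√(N n : ℝ)) :=
      (Real.mul_self_sqrt (Real.sqrt_nonneg _)).symm
    have hδ : (√(√(N n : ℝ)))⁻¹ * (√(entVar a))⁻¹ * √(N n * entVar a) = √(√(N n : ℝ)) := by
      rw [Real.sqrt_mul (Nat.cast_nonneg _) (entVar a)]
      nth_rewrite 2 [hsq]
      field_simp
    have hthr : N n * shannonH a + (y n + (√(√(N n : ℝ)))⁻¹ * (√(entVar a))⁻¹) *
        √(N n * entVar a) = A n + √(√(N n : ℝ)) - M n * Real.log d := by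
      rw [hn, add_mul, hδ]
      ring
    rw [hthr]
    exact kMaxSum_le_surprisalCDF_add ha (N n) (M n) (A n) _

end TensorPower

/-- central limit theorem for the total initial state
`Pⁿ = p^{⊗n} ⊗ η^{⊗mₙ}` and total target state `Qⁿ = q^{⊗mₙ} ⊗ η^{⊗n}`:
with `K_n(x) = ⌊exp(mₙ H(q) + n log d + x √(mₙ V(q)))⌋`, the sum of the `K_n(x)`
largest entries of `Qⁿ` tends to `Φ(x)`, and that of `Pⁿ` tends to `Φ_{μ,ν}(x)`
where `ν = (V(p)/D(p))/(V(q)/D(q))`, provided `mₙ - n R_μ(n)` stays bounded for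
`R_μ(n) = (1/D(q))(D(p) + μ √(D(p) V(q)/(D(q) n)))`. -/
theorem clt_total_states
    {d : ℕ} (p q : Fin d → ℝ) (hp : IsProbVec p) (hq : IsProbVec q)
    (hDp : 0 < relD p) (hDq : 0 < relD q) (hVp : 0 < entVar p) (hVq : 0 < entVar q)
    (μ : ℝ) (m : ℕ → ℕ) (hm : ∀ n, 0 < m n)
    (hbd : ∃ C : ℝ, ∀ n : ℕ,
      |(m n : ℝ) - n * ((1 / relD q) *
        (relD p + μ * Real.sqrt (relD p * entVar q / (relD q * n))))| ≤ C)
    (x : ℝ) :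
    Filter.Tendsto (fun n : ℕ =>
      kMaxSum (fun fg : (Fin (m n) → Fin d) × (Fin n → Fin d) =>
          tensorPow q (m n) fg.1 * tensorPow (fun _ : Fin d => (d : ℝ)⁻¹) n fg.2)
        ⌊Real.exp ((m n) * shannonH q + n * Real.log d
            + x * Real.sqrt ((m n) * entVar q))⌋₊)
      Filter.atTop (nhds (Phi x))
    ∧
    Filter.Tendsto (fun n : ℕ =>
      kMaxSum (fun fg : (Fin n → Fin d) × (Fin (m n) → Fin d) =>
          tensorPow p n fg.1 * tensorPow (fun _ : Fin d => (d : ℝ)⁻¹) (m n) fg.2)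
        ⌊Real.exp ((m n) * shannonH q + n * Real.log d
            + x * Real.sqrt ((m n) * entVar q))⌋₊)
      Filter.atTop
      (nhds (normCDF μ ((entVar p / relD p) / (entVar q / relD q)) x)) := by
  obtain ⟨C, hC⟩ := hbd
  set s : ℝ := √(relD p * entVar q / relD q) with hs
  have hsqrt : Tendsto (fun n : ℕ => √(n : ℝ)) atTop atTop :=
    Real.tendsto_sqrt_atTop.comp tendsto_natCast_atTop_atTop
  have hsplit (n : ℕ) : (n : ℝ) * ((1 / relD q) *
      (relD p + μ * √(relD p * entVar q / (relD q * n)))) =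
        (n * relD p + μ * s * √n) / relD q := by
    rw [← div_div, Real.sqrt_div (by positivity), ← hs]
    have : (n : ℝ) / √n = √n := Real.div_sqrt
    calc _ = (n * relD p + μ * s * (n / √n)) / relD q := by ring
      _ = _ := by rw [this]
  -- The defect of `m n * D(q)` from `n * D(p)` is of order `√n`.
  have hdef : Tendsto (fun n : ℕ => (m n * relD q - n * relD p) / √n) atTop (nhds (μ * s)) := by
    have herr : Tendsto (fun n : ℕ =>
        (m n - (n * relD p + μ * s * √n) / relD q) * (√n)⁻¹) atTop (nhds 0) := by
      refine bdd_le_mul_tendsto_zero' C (.of_forall fun n => ?_)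
        (tendsto_inv_atTop_zero.comp hsqrt)
      rw [← hsplit n]
      exact hC n
    have := (herr.const_mul (relD q)).add_const (μ * s)
    rw [mul_zero, zero_add] at this
    refine this.congr' ?_
    filter_upwards [hsqrt.eventually_gt_atTop 0] with n hn
    field_simp
    ring
  have hratio : Tendsto (fun n : ℕ => (m n : ℝ) / n) atTop (nhds (relD p / relD q)) := by
    have := ((hdef.mul (tendsto_inv_atTop_zero.comp hsqrt)).add_const (relD p)).div_const (relD q)
    rw [mul_zero, zero_add] at this
    refine this.congr' ?_
    filter_upwards [hsqrt.eventually_gt_atTop 0, eventually_gt_atTop 0] with n hn hn'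
    have hn'' : (0 : ℝ) < n := Nat.cast_pos.2 hn'
    have hsq : (√n : ℝ) ^ 2 = n := Real.sq_sqrt hn''.le
    simp only [Function.comp_apply]
    rw [← div_eq_mul_inv, div_div, ← sq, hsq]
    field_simp
    ring
  have hm_atTop : Tendsto m atTop atTop := by
    refine tendsto_natCast_atTop_iff (R := ℝ).1 ?_
    refine (hratio.pos_mul_atTop (div_pos hDp hDq) tendsto_natCast_atTop_atTop).congr' ?_
    filter_upwards [eventually_gt_atTop 0] with n hn
    have : (0 : ℝ) < n := Nat.cast_pos.2 hn
    field_simp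
  refine ⟨?_, ?_⟩
  · have := tendsto_kMaxSum_tensorPow_uniform hq hVq hm_atTop (M := fun n => n)
      (tendsto_const_nhds (x := x)) (.of_forall fun n => rfl)
    simpa [Phi, normCDF_eq_gaussianReal 0 one_pos x] using this
  · rw [normCDF_eq_gaussianReal μ (by positivity) x]
    refine tendsto_kMaxSum_tensorPow_uniform hp hVp tendsto_id (M := m)
      (y := fun n => (-((m n * relD q - n * relD p) / √n) + x * √(m n / n * entVar q)) /
        √(entVar p)) ?_ ?_
    · have hlim := (hdef.neg.add (((hratio.mul_const (entVar q)).sqrt).const_mul x)).div_const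
        √(entVar p)
      convert hlim using 2
      have hs' : √(relD p / relD q * entVar q) = s := by rw [hs]; congr 1; ring
      have hν : entVar p / relD p / (entVar q / relD q) =
          entVar p / (relD p * entVar q / relD q) := by
        field_simp
      rw [hs', hν, Real.sqrt_div hVp.le, ← hs]
      have : s ≠ 0 := (Real.sqrt_pos.2 (by positivity)).ne'
      have : √(entVar p) ≠ 0 := (Real.sqrt_pos.2 hVp).ne'
      field_simp
      ring
    · filter_upwards [hsqrt.eventually_gt_atTop 0] with n hn
      have : √(entVar p) ≠ 0 := (Real.sqrt_pos.2 hVp).ne'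
      have hmn : √((m n : ℝ) / n * entVar q) * √n = √(m n * entVar q) := by
        rw [← Real.sqrt_mul (by positivity)]
        congr 1
        have : (n : ℝ) ≠ 0 := (Real.sqrt_pos.1 hn).ne'
        field_simp
      rw [id, Real.sqrt_mul (Nat.cast_nonneg _) (entVar p), ← hmn]
      simp only [relD]
      field_simp
      ring
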